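/- The Bellman function 𝓑 is continuous on ℝ. More precisely, for every integer m ≥ 1, every x ∈ [0, 2^{m−1}] and every δ ∈ (0, 2^{−3m}], one has 0 ≤ 𝓑(x) − 𝓑(x + δ/2) ≤ 2^{−m}. -/

import Mathlib

open MeasureTheory

noncomputable section

/-- The dyadic subinterval `[k/2^n, (k+1)/2^n]` of `[0,1]`. -/
def dyadicI (n k : ℕ) : Set ℝ := Set.Icc ((k : ℝ) / 2 ^ n) (((k : ℝ) + 1) / 2 ^ n)

/-- The Haar function of the dyadic interval `[k/2^n, (k+1)/2^n]`: it equals `-1` on the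
left half of the interval, `+1` on its right half and `0` elsewhere. -/
def haar (n k : ℕ) (x : ℝ) : ℝ :=
  if x ∈ Set.Ico ((k : ℝ) / 2 ^ n) ((2 * (k : ℝ) + 1) / 2 ^ (n + 1)) then -1
  else if x ∈ Set.Ico ((2 * (k : ℝ) + 1) / 2 ^ (n + 1)) (((k : ℝ) + 1) / 2 ^ n) then 1
  else 0

/-- The Haar coefficient `a_J = μ(J)⁻¹ ∫_I f h_J` of `f` at `J = [k/2^n, (k+1)/2^n]`. -/
def haarCoeff (f : ℝ → ℝ) (n k : ℕ) : ℝ :=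
  2 ^ n * ∫ x in Set.Icc (0 : ℝ) 1, f x * haar n k x

/-- The dyadic square function `Sf = √(Σ_J a_J² χ_J)`. -/
def sqFn (f : ℝ → ℝ) (x : ℝ) : ℝ :=
  Real.sqrt (∑' p : ℕ × ℕ, (haarCoeff f p.1 p.2) ^ 2 * (dyadicI p.1 p.2).indicator 1 x)

/-- A test function for the Bellman function: integrable on `I = [0,1]`, with zero mean
and with dyadic square function essentially bounded by `1` on `I`. -/
def Admissible (f : ℝ → ℝ) : Prop :=
  IntegrableOn f (Set.Icc 0 1) ∧ (∫ x in Set.Icc (0 : ℝ) 1, f x) = 0 ∧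
    ∀ᵐ x ∂(volume.restrict (Set.Icc (0 : ℝ) 1)), sqFn f x ≤ 1

/-- The Bellman function `𝓑(x) = sup{ μ{f ≥ x} : ∫_I f = 0, ‖Sf‖_∞ ≤ 1 }`. -/
def bellman (x : ℝ) : ℝ :=
  sSup { m : ℝ | ∃ f : ℝ → ℝ, Admissible f ∧
    m = (volume { y ∈ Set.Icc (0 : ℝ) 1 | x ≤ f y }).toReal }

/-- The function on `[0,1]` whose left half is a rescaled copy of `u` and whose right half is a
rescaled copy of `v`. -/
def glue (u v : ℝ → ℝ) (x : ℝ) : ℝ := if x ≤ 1 / 2 then u (2 * x) else v (2 * x - 1)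

lemma glue_left {u v : ℝ → ℝ} {x : ℝ} (h : x ≤ 1 / 2) : glue u v x = u (2 * x) := if_pos h

lemma glue_right {u v : ℝ → ℝ} {x : ℝ} (h : 1 / 2 < x) : glue u v x = v (2 * x - 1) :=
  if_neg h.not_ge

lemma glue_integral {u v : ℝ → ℝ} (hu : IntegrableOn u (Set.Icc 0 1))
    (hv : IntegrableOn v (Set.Icc 0 1)) :
    IntegrableOn (glue u v) (Set.Icc 0 1) ∧
      ∫ x in Set.Icc (0 : ℝ) 1, glue u v x =
        ((∫ x in Set.Icc (0 : ℝ) 1, u x) + ∫ x in Set.Icc (0 : ℝ) 1, v x) / 2 := by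
  have h01 : (0 : ℝ) ≤ 1 := zero_le_one
  rw [← intervalIntegrable_iff_integrableOn_Icc_of_le h01] at hu hv ⊢
  simp only [integral_Icc_eq_integral_Ioc, ← intervalIntegral.integral_of_le h01]
  have eL : Set.EqOn (fun x => u (2 * x)) (glue u v) (Set.uIoc 0 (1 / 2)) := by
    intro x hx
    rw [Set.uIoc_of_le (by norm_num)] at hx
    exact (glue_left hx.2).symm
  have eR : Set.EqOn (fun x => v (2 * x - 1)) (glue u v) (Set.uIoc (1 / 2) 1) := by
    intro x hx
    rw [Set.uIoc_of_le (by norm_num)] at hx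
    exact (glue_right hx.1).symm
  have iL : IntervalIntegrable (glue u v) volume 0 (1 / 2) := by
    have := hu.comp_mul_left (c := 2)
    rw [zero_div] at this
    exact this.congr eL
  have iR : IntervalIntegrable (glue u v) volume (1 / 2) 1 := by
    have := (hv.comp_sub_right 1).comp_mul_left (c := 2)
    norm_num at this
    exact IntervalIntegrable.congr eR (by norm_num; exact this)
  refine ⟨iL.trans iR, ?_⟩
  rw [← intervalIntegral.integral_add_adjacent_intervals iL iR,
    ← intervalIntegral.integral_congr_ae (Filter.Eventually.of_forall eL),
    ← intervalIntegral.integral_congr_ae (Filter.Eventually.of_forall eR),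
    intervalIntegral.integral_comp_mul_left u two_ne_zero,
    intervalIntegral.integral_comp_mul_sub v two_ne_zero]
  norm_num
  ring

lemma measurable_haar (n k : ℕ) : Measurable (haar n k) :=
  Measurable.ite measurableSet_Ico measurable_const
    (Measurable.ite measurableSet_Ico measurable_const measurable_const)

lemma integrableOn_mul_haar {f : ℝ → ℝ} (hf : IntegrableOn f (Set.Icc 0 1)) (n k : ℕ) :
    IntegrableOn (fun x => f x * haar n k x) (Set.Icc 0 1) := by
  refine Integrable.mul_bdd (c := 1) hf (measurable_haar n k).aestronglyMeasurable
    (Filter.Eventually.of_forall fun x => ?_)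
  unfold haar
  split_ifs <;> simp

lemma haar_of_lt_one {n k : ℕ} (hk : 2 ^ n ≤ k) {x : ℝ} (hx : x < 1) : haar n k x = 0 := by
  have h1 : (1 : ℝ) ≤ k / 2 ^ n := by
    rw [le_div_iff₀ (by positivity), one_mul]
    exact_mod_cast hk
  have h2 : (k : ℝ) / 2 ^ n ≤ (2 * k + 1) / 2 ^ (n + 1) := by
    rw [div_le_div_iff₀ (by positivity) (by positivity), pow_succ]
    nlinarith [pow_pos (zero_lt_two' ℝ) n]
  unfold haar
  rw [if_neg fun h => by linarith [h.1], if_neg fun h => by linarith [h.1]]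

lemma haarCoeff_of_le (f : ℝ → ℝ) {n k : ℕ} (hk : 2 ^ n ≤ k) : haarCoeff f n k = 0 := by
  unfold haarCoeff
  rw [integral_Icc_eq_integral_Ico, setIntegral_eq_zero_of_forall_eq_zero, mul_zero]
  intro x hx
  rw [haar_of_lt_one hk hx.2, mul_zero]

lemma mem_Ico_half (a b x : ℝ) (m n : ℕ) :
    x ∈ Set.Ico (a / 2 ^ (m + 1)) (b / 2 ^ (n + 1)) ↔
      2 * x ∈ Set.Ico (a / 2 ^ m) (b / 2 ^ n) := by
  have h (n : ℕ) : (0 : ℝ) < 2 ^ n := by positivity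
  simp only [Set.mem_Ico, div_le_iff₀, lt_div_iff₀, pow_succ, h, mul_pos, zero_lt_two]
  constructor <;> rintro ⟨h1, h2⟩ <;> constructor <;> linarith

lemma mem_Ico_sub_one (a b x : ℝ) (m n : ℕ) :
    x - 1 ∈ Set.Ico (a / 2 ^ m) (b / 2 ^ n) ↔
      x ∈ Set.Ico ((2 ^ m + a) / 2 ^ m) ((2 ^ n + b) / 2 ^ n) := by
  have h (n : ℕ) : (2 : ℝ) ^ n ≠ 0 := by positivity
  simp only [Set.mem_Ico, add_div, div_self (h _)]
  constructor <;> rintro ⟨h1, h2⟩ <;> constructor <;> linarith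

lemma haar_succ (n k : ℕ) (x : ℝ) : haar (n + 1) k x = haar n k (2 * x) := by
  unfold haar
  simp only [mem_Ico_half]

lemma haar_sub_one (n k : ℕ) (x : ℝ) : haar n k (x - 1) = haar n (2 ^ n + k) x := by
  unfold haar
  simp only [mem_Ico_sub_one]
  push_cast
  congr! 4 <;> ring

lemma haar_of_one_le {n k : ℕ} (hk : k < 2 ^ n) {x : ℝ} (hx : 1 ≤ x) : haar n k x = 0 := by
  have h1 : ((k : ℝ) + 1) / 2 ^ n ≤ 1 := by
    rw [div_le_one (by positivity)]
    exact_mod_cast hk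
  have h2 : (2 * (k : ℝ) + 1) / 2 ^ (n + 1) ≤ (k + 1) / 2 ^ n := by
    rw [div_le_div_iff₀ (by positivity) (by positivity), pow_succ]
    nlinarith [pow_pos (zero_lt_two' ℝ) n]
  unfold haar
  rw [if_neg fun h => by linarith [h.2], if_neg fun h => by linarith [h.2]]

lemma haar_zero_zero (x : ℝ) :
    haar 0 0 x = if 0 ≤ x ∧ x < 1 / 2 then -1 else if 1 / 2 ≤ x ∧ x < 1 then 1 else 0 := by
  simp [haar]

lemma haarCoeff_glue_zero {u v : ℝ → ℝ} (hu : IntegrableOn u (Set.Icc 0 1))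
    (hv : IntegrableOn v (Set.Icc 0 1)) :
    haarCoeff (glue u v) 0 0 =
      ((∫ x in Set.Icc (0 : ℝ) 1, v x) - ∫ x in Set.Icc (0 : ℝ) 1, u x) / 2 := by
  have h : ∫ x in Set.Icc (0 : ℝ) 1, glue u v x * haar 0 0 x =
      ∫ x in Set.Icc (0 : ℝ) 1, glue (-u) v x := by
    rw [integral_Icc_eq_integral_Ioo, integral_Icc_eq_integral_Ioo]
    refine setIntegral_congr_ae measurableSet_Ioo ?_
    filter_upwards [Measure.ae_ne volume (1 / 2 : ℝ)] with x hx hx'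
    rw [haar_zero_zero]
    rcases lt_or_gt_of_ne hx with h | h
    · rw [if_pos ⟨hx'.1.le, h⟩, glue_left h.le, glue_left h.le]
      simp
    · rw [if_neg fun h' => by linarith [h'.2], if_pos ⟨h.le, hx'.2⟩, glue_right h, glue_right h,
        mul_one]
  unfold haarCoeff
  rw [h, (glue_integral hu.neg hv).2]
  simp only [Pi.neg_apply, integral_neg]
  ring

lemma haarCoeff_glue_left {u v : ℝ → ℝ} (hu : IntegrableOn u (Set.Icc 0 1))
    {n k : ℕ} (hk : k < 2 ^ n) :
    haarCoeff (glue u v) (n + 1) k = haarCoeff u n k := by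
  have h : ∀ x, glue u v x * haar (n + 1) k x = glue (fun y => u y * haar n k y) (fun _ => 0) x := by
    intro x
    rw [haar_succ]
    rcases le_or_gt x (1 / 2) with hx | hx
    · rw [glue_left hx, glue_left hx]
    · rw [glue_right hx, glue_right hx, haar_of_one_le hk (by linarith)]
      simp
  unfold haarCoeff
  simp only [h]
  rw [(glue_integral (integrableOn_mul_haar hu n k) integrableOn_zero).2]
  simp
  ring

lemma haarCoeff_glue_right {u v : ℝ → ℝ} (hv : IntegrableOn v (Set.Icc 0 1)) (n k : ℕ) :
    haarCoeff (glue u v) (n + 1) (2 ^ n + k) = haarCoeff v n k := by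
  have h : ∀ᵐ x : ℝ, x ∈ Set.Icc (0 : ℝ) 1 → glue u v x * haar (n + 1) (2 ^ n + k) x =
      glue (fun _ => 0) (fun y => v y * haar n k y) x := by
    filter_upwards [Measure.ae_ne volume (1 / 2 : ℝ)] with x hx _
    rw [haar_succ]
    rcases lt_or_gt_of_ne hx with hx | hx
    · rw [glue_left hx.le, glue_left hx.le, haar_of_lt_one (by omega) (by linarith)]
      simp
    · rw [glue_right hx, glue_right hx, haar_sub_one]
  unfold haarCoeff
  rw [setIntegral_congr_ae measurableSet_Icc h,
    (glue_integral integrableOn_zero (integrableOn_mul_haar hv n k)).2]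
  simp
  ring

lemma haarCoeff_const (c : ℝ) (n k : ℕ) : haarCoeff (fun _ => c) n k = 0 := by
  have hg : (fun _ => c) = glue (fun _ => c) fun _ => c := by
    ext x
    simp [glue]
  have hc : IntegrableOn (fun _ : ℝ => c) (Set.Icc 0 1) := by simp
  induction n generalizing k with
  | zero =>
    rcases Nat.eq_zero_or_pos k with rfl | hk
    · rw [hg, haarCoeff_glue_zero hc hc, sub_self, zero_div]
    · exact haarCoeff_of_le _ hk
  | succ n ih =>
    rcases lt_or_ge k (2 ^ n) with hk | hk
    · rw [hg, haarCoeff_glue_left hc hk, ih]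
    · obtain ⟨j, rfl⟩ := Nat.exists_eq_add_of_le hk
      rw [hg, haarCoeff_glue_right hc, ih]

lemma haarCoeff_affine {f : ℝ → ℝ} (hf : IntegrableOn f (Set.Icc 0 1)) (c s : ℝ) (n k : ℕ) :
    haarCoeff (fun x => c + s * f x) n k = s * haarCoeff f n k := by
  have hc : IntegrableOn (fun _ : ℝ => c) (Set.Icc 0 1) := by simp
  have h := haarCoeff_const c n k
  unfold haarCoeff at h ⊢
  simp only [add_mul, mul_assoc]
  rw [integral_add (integrableOn_mul_haar hc n k) ((integrableOn_mul_haar hf n k).const_mul s), integral_const_mul s,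
    mul_add, h]
  ring

lemma sqrt_tsum_le_one {ι : Type*} [DecidableEq ι] {F G : ι → ℝ} {e : ι → ι}
    (he : Function.Injective e) {i : ι} {a s : ℝ} (hs : s ≠ 0) (has : a ^ 2 + s ^ 2 = 1)
    (hi : i ∉ Set.range e) (hG : ∀ p, G (e p) = s ^ 2 * F p) (hGi : G i = a ^ 2)
    (hG0 : ∀ p ∉ Set.range e, p ≠ i → G p = 0) (hF : √(∑' p, F p) ≤ 1) : √(∑' p, G p) ≤ 1 := by
  have hs2 : s ^ 2 ≠ 0 := pow_ne_zero 2 hs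
  have hcomp : G ∘ e = fun p => s ^ 2 * F p := funext hG
  by_cases hsum : Summable F
  · have h1 : HasSum (fun p => G p - (Pi.single i (a ^ 2) : ι → ℝ) p) (s ^ 2 * ∑' p, F p) := by
      rw [← he.hasSum_iff]
      · have h : (fun p => G p - (Pi.single i (a ^ 2) : ι → ℝ) p) ∘ e = fun p => s ^ 2 * F p := by
          funext p
          have : e p ≠ i := fun h => hi ⟨p, h⟩
          simp [this, hG]
        rw [h]
        exact hsum.hasSum.mul_left (s ^ 2)
      · intro p hp
        rcases eq_or_ne p i with rfl | hpi
        · simp [hGi]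
        · simp [hpi, hG0 p hp hpi]
    have h2 := h1.add (hasSum_pi_single i (a ^ 2))
    simp only [sub_add_cancel] at h2
    rw [h2.tsum_eq, Real.sqrt_le_iff]
    rw [Real.sqrt_le_iff] at hF
    refine ⟨zero_le_one, ?_⟩
    nlinarith [hF.2, sq_nonneg s]
  · have hnG : ¬ Summable G := by
      intro h
      have := h.comp_injective he
      rw [hcomp, summable_mul_left_iff hs2] at this
      exact hsum this
    rw [tsum_eq_zero_of_not_summable hnG]
    simp

lemma mem_dyadicI_succ (n k : ℕ) (x : ℝ) : x ∈ dyadicI (n + 1) k ↔ 2 * x ∈ dyadicI n k := by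
  have h : (0 : ℝ) < 2 ^ n := by positivity
  simp only [dyadicI, Set.mem_Icc, div_le_iff₀, le_div_iff₀, pow_succ, h, mul_pos, zero_lt_two]
  constructor <;> rintro ⟨h1, h2⟩ <;> constructor <;> linarith

lemma mem_dyadicI_sub_one (n k : ℕ) (x : ℝ) : x - 1 ∈ dyadicI n k ↔ x ∈ dyadicI n (2 ^ n + k) := by
  have h : (2 : ℝ) ^ n ≠ 0 := by positivity
  simp only [dyadicI, Set.mem_Icc]
  push_cast
  rw [add_assoc, add_div (2 ^ n) (k : ℝ), add_div (2 ^ n) ((k : ℝ) + 1), div_self h]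
  constructor <;> rintro ⟨h1, h2⟩ <;> constructor <;> linarith

lemma indicator_one_congr {A B : Set ℝ} {x y : ℝ} (h : x ∈ A ↔ y ∈ B) :
    A.indicator (1 : ℝ → ℝ) x = B.indicator 1 y := by
  by_cases hx : x ∈ A
  · simp [hx, h.1 hx]
  · simp [hx, mt h.2 hx]

lemma lt_of_mem_dyadicI {n k : ℕ} {x : ℝ} (hx : x < 1) (h : x ∈ dyadicI n k) : k < 2 ^ n := by
  have := h.1.trans_lt hx
  rw [div_lt_one (by positivity)] at this
  exact_mod_cast this

lemma le_of_mem_dyadicI {n k : ℕ} {x : ℝ} (hx : 1 < x) (h : x ∈ dyadicI n k) : 2 ^ n ≤ k := by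
  have := hx.trans_le h.2
  rw [one_lt_div (by positivity)] at this
  have h' : 2 ^ n < k + 1 := by exact_mod_cast this
  omega

section Glue

variable {f₁ f₂ : ℝ → ℝ} {a s : ℝ}

lemma affine_integral {f : ℝ → ℝ} (hf : Admissible f) (c s : ℝ) :
    IntegrableOn (fun x => c + s * f x) (Set.Icc 0 1) ∧
      ∫ x in Set.Icc (0 : ℝ) 1, c + s * f x = c := by
  have hc : IntegrableOn (fun _ : ℝ => c) (Set.Icc 0 1) := by simp
  refine ⟨hc.add (hf.1.const_mul s), ?_⟩
  rw [integral_add hc (hf.1.const_mul s), integral_const_mul, hf.2.1]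
  simp

lemma haarCoeff_glue_affine_zero (h₁ : Admissible f₁) (h₂ : Admissible f₂) :
    haarCoeff (glue (fun x => -a + s * f₁ x) fun x => a + s * f₂ x) 0 0 = a := by
  rw [haarCoeff_glue_zero (affine_integral h₁ _ s).1 (affine_integral h₂ _ s).1,
    (affine_integral h₁ _ s).2, (affine_integral h₂ _ s).2]
  ring

lemma sqFn_glue_left (h₁ : Admissible f₁) (h₂ : Admissible f₂) (hs : s ≠ 0)
    (has : a ^ 2 + s ^ 2 = 1) {x : ℝ} (hx : x ∈ Set.Ico (0 : ℝ) (1 / 2))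
    (hf : sqFn f₁ (2 * x) ≤ 1) :
    sqFn (glue (fun x => -a + s * f₁ x) fun x => a + s * f₂ x) x ≤ 1 := by
  refine sqrt_tsum_le_one (e := fun p => (p.1 + 1, p.2)) (i := (0, 0)) ?_ hs has ?_ ?_ ?_ ?_ hf
  · rintro ⟨n, k⟩ ⟨n', k'⟩ h
    simpa using h
  · rintro ⟨p, hp⟩
    simp at hp
  · rintro ⟨n, k⟩
    simp only
    rcases lt_or_ge k (2 ^ n) with hk | hk
    · rw [haarCoeff_glue_left (affine_integral h₁ _ s).1 hk, haarCoeff_affine h₁.1]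
      rw [indicator_one_congr (mem_dyadicI_succ n k x)]
      ring
    · rw [haarCoeff_of_le f₁ hk, Set.indicator_of_notMem]
      · simp
      · rw [mem_dyadicI_succ]
        intro h
        exact absurd (lt_of_mem_dyadicI (by linarith [hx.2]) h) (by omega)
  · rw [haarCoeff_glue_affine_zero h₁ h₂, Set.indicator_of_mem]
    · simp
    · simp only [dyadicI, Set.mem_Icc]
      norm_num
      constructor <;> linarith [hx.1, hx.2]
  · rintro ⟨_ | n, k⟩ hp hne
    · rw [haarCoeff_of_le _ (by simp at hne; simp; omega)]
      simp
    · exact absurd ⟨(n, k), rfl⟩ hp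

lemma sqFn_glue_right (h₁ : Admissible f₁) (h₂ : Admissible f₂) (hs : s ≠ 0)
    (has : a ^ 2 + s ^ 2 = 1) {x : ℝ} (hx : x ∈ Set.Ioc (1 / 2 : ℝ) 1)
    (hf : sqFn f₂ (2 * x - 1) ≤ 1) :
    sqFn (glue (fun x => -a + s * f₁ x) fun x => a + s * f₂ x) x ≤ 1 := by
  refine sqrt_tsum_le_one (e := fun p => (p.1 + 1, 2 ^ p.1 + p.2)) (i := (0, 0))
    ?_ hs has ?_ ?_ ?_ ?_ hf
  · rintro ⟨n, k⟩ ⟨n', k'⟩ h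
    simp only [Prod.mk.injEq, add_left_inj] at h
    obtain ⟨rfl, h⟩ := h
    simpa using h
  · rintro ⟨p, hp⟩
    simp at hp
  · rintro ⟨n, k⟩
    simp only
    rw [haarCoeff_glue_right (affine_integral h₂ _ s).1, haarCoeff_affine h₂.1]
    rw [indicator_one_congr ((mem_dyadicI_succ _ _ x).trans (mem_dyadicI_sub_one n k _).symm)]
    ring
  · rw [haarCoeff_glue_affine_zero h₁ h₂, Set.indicator_of_mem]
    · simp
    · simp only [dyadicI, Set.mem_Icc]
      norm_num
      constructor <;> linarith [hx.1, hx.2]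
  · rintro ⟨_ | n, k⟩ hp hne
    · rw [haarCoeff_of_le _ (by simp at hne; simp; omega)]
      simp
    · rw [Set.indicator_of_notMem, mul_zero]
      rw [mem_dyadicI_succ]
      intro h
      obtain ⟨j, rfl⟩ := Nat.exists_eq_add_of_le (le_of_mem_dyadicI (by linarith [hx.1]) h)
      exact hp ⟨(n, j), rfl⟩

lemma volume_preimage_two_mul_sub (c : ℝ) (t : Set ℝ) :
    volume ((fun x : ℝ => 2 * x - c) ⁻¹' t) = ENNReal.ofReal (1 / 2) * volume t := by
  have : (fun x : ℝ => 2 * x - c) ⁻¹' t = (2 * ·) ⁻¹' ((· + -c) ⁻¹' t) := by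
    ext x
    simp [sub_eq_add_neg]
  rw [this, Real.volume_preimage_mul_left two_ne_zero, measure_preimage_add_right]
  norm_num

lemma ae_comp_two_mul_sub (c : ℝ) {P : ℝ → Prop} (h : ∀ᵐ x : ℝ, P x) :
    ∀ᵐ x : ℝ, P (2 * x - c) := by
  rw [ae_iff] at h ⊢
  have := volume_preimage_two_mul_sub c {x | ¬ P x}
  rwa [h, mul_zero] at this

lemma admissible_glue (h₁ : Admissible f₁) (h₂ : Admissible f₂) (hs : s ≠ 0)
    (has : a ^ 2 + s ^ 2 = 1) :
    Admissible (glue (fun x => -a + s * f₁ x) fun x => a + s * f₂ x) := by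
  have hg := glue_integral (affine_integral h₁ (-a) s).1 (affine_integral h₂ a s).1
  refine ⟨hg.1, ?_, ?_⟩
  · rw [hg.2, (affine_integral h₁ _ s).2, (affine_integral h₂ _ s).2]
    ring
  · have e₁ := h₁.2.2
    have e₂ := h₂.2.2
    rw [ae_restrict_iff' measurableSet_Icc] at e₁ e₂ ⊢
    filter_upwards [ae_comp_two_mul_sub 0 e₁, ae_comp_two_mul_sub 1 e₂,
      Measure.ae_ne volume (1 / 2 : ℝ)] with x hx₁ hx₂ hne hx
    rw [sub_zero] at hx₁
    rcases lt_or_gt_of_ne hne with h | h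
    · exact sqFn_glue_left h₁ h₂ hs has ⟨hx.1, h⟩
        (hx₁ ⟨by linarith [hx.1], by linarith⟩)
    · exact sqFn_glue_right h₁ h₂ hs has ⟨h, hx.2⟩
        (hx₂ ⟨by linarith, by linarith [hx.2]⟩)

lemma volume_glue_ge {y u v : ℝ} (hs : 0 < s) (hu : y + a ≤ s * u) (hv : y - a ≤ s * v) :
    ENNReal.ofReal (1 / 2) * volume {x ∈ Set.Icc (0 : ℝ) 1 | u ≤ f₁ x} +
        ENNReal.ofReal (1 / 2) * volume {x ∈ Set.Icc (0 : ℝ) 1 | v ≤ f₂ x} ≤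
      volume {x ∈ Set.Icc (0 : ℝ) 1 |
        y ≤ glue (fun x => -a + s * f₁ x) (fun x => a + s * f₂ x) x} := by
  rw [← measure_inter_add_sdiff {x ∈ Set.Icc (0 : ℝ) 1 |
    y ≤ glue (fun x => -a + s * f₁ x) (fun x => a + s * f₂ x) x} (measurableSet_Iic (a := 1 / 2)),
    ← measure_sdiff_null (s := {x ∈ Set.Icc (0 : ℝ) 1 | v ≤ f₂ x}) (measure_singleton (0 : ℝ)),
    ← volume_preimage_two_mul_sub 0, ← volume_preimage_two_mul_sub 1]
  refine add_le_add (measure_mono ?_) (measure_mono ?_)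
  · rintro x ⟨⟨h0, h1⟩, h⟩
    simp only [sub_zero] at h0 h1 h
    have hx : x ≤ 1 / 2 := by linarith
    refine ⟨⟨⟨by linarith, by linarith⟩, ?_⟩, hx⟩
    rw [glue_left hx]
    nlinarith
  · rintro x ⟨⟨⟨h0, h1⟩, h⟩, hne⟩
    simp only at h0 h1 h
    have hx : 1 / 2 < x := by
      have : 0 < 2 * x - 1 := lt_of_le_of_ne h0 fun h => hne h.symm
      linarith
    refine ⟨⟨⟨by linarith, by linarith⟩, ?_⟩, fun h => hx.not_ge h⟩
    rw [glue_right hx]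
    nlinarith

end Glue

lemma volume_level_le (f : ℝ → ℝ) (x : ℝ) :
    volume {y ∈ Set.Icc (0 : ℝ) 1 | x ≤ f y} ≤ 1 := by
  refine (measure_mono (Set.sep_subset _ _)).trans ?_
  simp

lemma admissible_zero : Admissible 0 := by
  have h (n k : ℕ) : haarCoeff 0 n k = 0 := haarCoeff_const 0 n k
  refine ⟨integrableOn_zero, by simp, Filter.Eventually.of_forall fun x => ?_⟩
  simp [sqFn, h]

lemma level_le_bellman {f : ℝ → ℝ} (hf : Admissible f) (x : ℝ) :
    (volume {y ∈ Set.Icc (0 : ℝ) 1 | x ≤ f y}).toReal ≤ bellman x := by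
  refine le_csSup ⟨1, ?_⟩ ⟨f, hf, rfl⟩
  rintro _ ⟨g, -, rfl⟩
  exact ENNReal.toReal_le_of_le_ofReal zero_le_one (by simpa using volume_level_le g x)

lemma bellman_le {x b : ℝ}
    (h : ∀ f, Admissible f → (volume {y ∈ Set.Icc (0 : ℝ) 1 | x ≤ f y}).toReal ≤ b) :
    bellman x ≤ b := by
  refine csSup_le ⟨_, 0, admissible_zero, rfl⟩ ?_
  rintro _ ⟨f, hf, rfl⟩
  exact h f hf

lemma bellman_nonneg (x : ℝ) : 0 ≤ bellman x :=
  ENNReal.toReal_nonneg.trans (level_le_bellman admissible_zero x)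

lemma bellman_le_one (x : ℝ) : bellman x ≤ 1 :=
  bellman_le fun f _ =>
    ENNReal.toReal_le_of_le_ofReal zero_le_one (by simpa using volume_level_le f x)

lemma bellman_of_nonpos {x : ℝ} (hx : x ≤ 0) : bellman x = 1 := by
  refine (bellman_le_one x).antisymm ?_
  have := level_le_bellman admissible_zero x
  have hset : {y ∈ Set.Icc (0 : ℝ) 1 | x ≤ (0 : ℝ → ℝ) y} = Set.Icc 0 1 :=
    Set.sep_eq_self_iff_mem_true.2 fun _ _ => hx
  rw [hset] at this
  simpa using this

lemma bellman_antitone : Antitone bellman := by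
  intro x y hxy
  refine bellman_le fun f hf => le_trans ?_ (level_le_bellman hf x)
  refine ENNReal.toReal_mono (ne_top_of_le_ne_top ENNReal.one_ne_top (volume_level_le f x)) ?_
  exact measure_mono fun z hz => ⟨hz.1, hxy.trans hz.2⟩

lemma bellman_add_le {a s y u v : ℝ} (hs : 0 < s) (has : a ^ 2 + s ^ 2 = 1)
    (hu : y + a ≤ s * u) (hv : y - a ≤ s * v) : bellman u + bellman v ≤ 2 * bellman y := by
  have key : ∀ f₁, Admissible f₁ → ∀ f₂, Admissible f₂ →
      (volume {x ∈ Set.Icc (0 : ℝ) 1 | u ≤ f₁ x}).toReal +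
        (volume {x ∈ Set.Icc (0 : ℝ) 1 | v ≤ f₂ x}).toReal ≤ 2 * bellman y := by
    intro f₁ h₁ f₂ h₂
    have hle := level_le_bellman (admissible_glue h₁ h₂ hs.ne' has) y
    have hm := ENNReal.toReal_mono
      (ne_top_of_le_ne_top ENNReal.one_ne_top (volume_level_le _ y))
      (volume_glue_ge (f₁ := f₁) (f₂ := f₂) hs hu hv)
    have t₁ := ne_top_of_le_ne_top ENNReal.one_ne_top (volume_level_le f₁ u)
    have t₂ := ne_top_of_le_ne_top ENNReal.one_ne_top (volume_level_le f₂ v)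
    rw [ENNReal.toReal_add (ENNReal.mul_ne_top ENNReal.ofReal_ne_top t₁)
      (ENNReal.mul_ne_top ENNReal.ofReal_ne_top t₂), ENNReal.toReal_mul, ENNReal.toReal_mul,
      ENNReal.toReal_ofReal (by norm_num)] at hm
    linarith
  rw [← le_sub_iff_add_le]
  refine bellman_le fun f₁ h₁ => ?_
  rw [le_sub_comm]
  exact bellman_le fun f₂ h₂ => by linarith [key f₁ h₁ f₂ h₂]

/-- The decrement of `bellman` over an interval is at most the one over a slightly longer
neighbouring interval to its right. -/
lemma bellman_sub_le {x d a X η : ℝ} (hx : 0 ≤ x) (ha0 : 0 ≤ a) (ha1 : a < 1) (hd : 0 ≤ d)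
    (hη : 0 ≤ η) (haη : a = d + η / 2) (hX : x + 2 * d + η ≤ X) (hXa : X * a ^ 2 ≤ η / 2) :
    bellman x - bellman (x + d) ≤ bellman (x + d) - bellman (x + 2 * d + η) := by
  have h1 : 0 < 1 - a ^ 2 := by nlinarith
  have hs : 0 < √(1 - a ^ 2) := Real.sqrt_pos.2 h1
  have hs2 : √(1 - a ^ 2) ^ 2 = 1 - a ^ 2 := Real.sq_sqrt h1.le
  have hs3 : 1 - a ^ 2 ≤ √(1 - a ^ 2) := Real.le_sqrt_of_sq_le (by nlinarith)
  have := bellman_add_le (a := a) (s := √(1 - a ^ 2)) (y := x + d) (u := x + 2 * d + η)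
    (v := x) hs (by linarith) (by nlinarith [sq_nonneg a]) (by nlinarith [sq_nonneg a])
  linarith

lemma bellman_sub_le_inv_pow {m : ℕ} (hm : 1 ≤ m) {x : ℝ} (hx0 : 0 ≤ x) (hx : x ≤ 2 ^ (m - 1))
    {δ : ℝ} (hδ0 : 0 < δ) (hδ : δ ≤ ((2 : ℝ) ^ (3 * m))⁻¹) :
    bellman x - bellman (x + δ / 2) ≤ ((2 : ℝ) ^ m)⁻¹ := by
  obtain ⟨N, hN⟩ : ∃ N : ℝ, N = 2 ^ m := ⟨_, rfl⟩
  have hN2 : 2 ≤ N := by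
    rw [hN]
    simpa using pow_le_pow_right₀ (one_le_two (α := ℝ)) hm
  have hxN : x ≤ N / 2 := by
    obtain ⟨j, rfl⟩ := Nat.exists_eq_add_of_le' hm
    rw [hN, pow_succ]
    simpa using hx
  have hδN : δ * N ^ 3 ≤ 1 := by
    rw [hN, ← pow_mul, mul_comm m 3, ← le_div_iff₀ (by positivity), one_div]
    exact hδ
  have hδN2 : N ^ 2 * δ ≤ 1 / 2 := by nlinarith [mul_nonneg hδ0.le (sq_nonneg N)]
  have hδN1 : N * δ ≤ 1 / 4 := by nlinarith [mul_nonneg hδ0.le (by linarith : 0 ≤ N)]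
  have hδ1 : δ ≤ 1 / 8 := by nlinarith
  obtain ⟨η, hη⟩ : ∃ η, η = 5 / 4 * N * δ ^ 2 := ⟨_, rfl⟩
  have hη0 : 0 ≤ η := by rw [hη]; positivity
  have hηN : (N - 1) * η ≤ δ / 2 := by
    have : (N - 1) * N * (5 / 4 * δ) ≤ 1 / 2 := by nlinarith
    rw [hη]
    nlinarith
  let p : ℕ → ℝ := fun k => x + k * (δ / 2) + k * (k - 1) / 2 * η
  have hstep (k : ℕ) (hk : (k : ℝ) + 2 ≤ N) :
      bellman (p k) - bellman (p (k + 1)) ≤ bellman (p (k + 1)) - bellman (p (k + 2)) := by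
    have hk0 : (0 : ℝ) ≤ k := k.cast_nonneg
    have hkη : k * η + η ≤ δ / 2 := by nlinarith
    have hp0 : 0 ≤ p k - x := by
      rcases Nat.eq_zero_or_pos k with rfl | h
      · simp [p]
      · have : (1 : ℝ) ≤ k := by exact_mod_cast h
        have := mul_nonneg (mul_nonneg hk0 (sub_nonneg.2 this)) hη0
        simp only [p]
        nlinarith
    have hpX : p (k + 2) ≤ x + N * δ := by
      have h2 : (k + 2 : ℝ) * ((k + 1) / 2 * η) ≤ N * (δ / 2) :=
        mul_le_mul hk (by nlinarith) (by positivity) (by linarith)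
      have h3 : (k + 2 : ℝ) * (δ / 2) ≤ N * (δ / 2) :=
        mul_le_mul_of_nonneg_right hk (by linarith)
      simp only [p]
      push_cast
      linarith
    have e1 : p (k + 1) = p k + (δ / 2 + k * η) := by simp only [p]; push_cast; ring
    have e2 : p (k + 2) = p k + 2 * (δ / 2 + k * η) + η := by simp only [p]; push_cast; ring
    have ha : δ / 2 + k * η + η / 2 ≤ δ := by linarith
    have ha0 : 0 ≤ δ / 2 + k * η + η / 2 := by positivity
    rw [e2] at hpX
    rw [e1, e2]
    refine bellman_sub_le (a := δ / 2 + k * η + η / 2) (X := 5 / 8 * N) (by linarith) ha0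
      (by linarith) (by positivity) hη0 rfl (by linarith) ?_
    have : (δ / 2 + k * η + η / 2) ^ 2 ≤ δ ^ 2 := pow_le_pow_left₀ ha0 ha 2
    rw [hη] at this ⊢
    nlinarith
  have hmono (k : ℕ) (hk : (k : ℝ) + 1 ≤ N) :
      bellman (p 0) - bellman (p 1) ≤ bellman (p k) - bellman (p (k + 1)) := by
    induction k with
    | zero => simp
    | succ k ih =>
      push_cast at hk
      exact (ih (by linarith)).trans (hstep k (by linarith))
  have hsum : N * (bellman (p 0) - bellman (p 1)) ≤ bellman (p 0) - bellman (p (2 ^ m)) := by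
    have := Finset.card_nsmul_le_sum (Finset.range (2 ^ m))
      (fun k => bellman (p k) - bellman (p (k + 1))) (bellman (p 0) - bellman (p 1))
      fun k hk => hmono k (by rw [hN]; exact_mod_cast Finset.mem_range.1 hk)
    rw [Finset.sum_range_sub' (fun k => bellman (p k)), Finset.card_range, nsmul_eq_mul] at this
    rw [hN]
    exact_mod_cast this
  have e0 : p 0 = x := by simp [p]
  have e1 : p 1 = x + δ / 2 := by simp [p]
  rw [e0, e1] at hsum
  rw [← hN, ← one_div, le_div_iff₀ (by linarith)]
  linarith [bellman_le_one x, bellman_nonneg (p (2 ^ m))]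

lemma bellman_max_zero (t : ℝ) : bellman (max t 0) = bellman t := by
  rcases le_total t 0 with h | h
  · rw [max_eq_right h, bellman_of_nonpos h, bellman_of_nonpos le_rfl]
  · rw [max_eq_left h]

lemma continuous_bellman : Continuous bellman := by
  rw [Metric.continuous_iff]
  intro p ε hε
  obtain ⟨n, hn⟩ := pow_unbounded_of_one_lt (max p ε⁻¹) (one_lt_two (α := ℝ))
  have hpn : p < 2 ^ n := (le_max_left _ _).trans_lt hn
  have hεn : ((2 : ℝ) ^ (n + 1))⁻¹ < ε := by
    have : ε⁻¹ < 2 ^ (n + 1) := ((le_max_right _ _).trans_lt hn).trans (by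
      rw [pow_succ]; linarith [pow_pos (zero_lt_two' ℝ) n])
    exact inv_lt_of_inv_lt₀ hε this
  set δ : ℝ := ((2 : ℝ) ^ (3 * (n + 1)))⁻¹
  have hδ : 0 < δ := by positivity
  have hmain := bellman_sub_le_inv_pow (m := n + 1) (by omega) (le_max_right (p - δ / 8) 0)
    (max_le (by simp; linarith) (by positivity)) hδ le_rfl
  rw [bellman_max_zero] at hmain
  have hlow : ∀ q, |q - p| < δ / 8 →
      bellman q ≤ bellman (p - δ / 8) ∧
        bellman (max (p - δ / 8) 0 + δ / 2) ≤ bellman q := by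
    intro q hq
    rw [abs_lt] at hq
    exact ⟨bellman_antitone (by linarith),
      bellman_antitone (by linarith [le_max_left (p - δ / 8) 0])⟩
  refine ⟨δ / 8, by positivity, fun q hq => ?_⟩
  have h1 := hlow q (by rwa [Real.dist_eq] at hq)
  have h2 := hlow p (by simpa using hδ)
  rw [Real.dist_eq, abs_lt]
  constructor <;> linarith [h1.1, h1.2, h2.1, h2.2]

theorem bellman_continuous :
    Continuous bellman ∧
      ∀ m : ℕ, 1 ≤ m → ∀ x ∈ Set.Icc (0 : ℝ) (2 ^ (m - 1)),
        ∀ δ ∈ Set.Ioc (0 : ℝ) (((2 : ℝ) ^ (3 * m))⁻¹),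
          0 ≤ bellman x - bellman (x + δ / 2) ∧
            bellman x - bellman (x + δ / 2) ≤ ((2 : ℝ) ^ m)⁻¹ := by
  refine ⟨continuous_bellman, fun m hm x hx δ hδ => ⟨?_, ?_⟩⟩
  · exact sub_nonneg.2 (bellman_antitone (by linarith [hδ.1]))
  · exact bellman_sub_le_inv_pow hm hx.1 hx.2 hδ.1 hδ.2
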